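/- Let n ≥ 2 and let x₀,…,xₙ be positive real numbers. Then det M(x₀,…,xₙ) ≥ 0 if and only if (Σ_{α=0}^{n} 1/x_α)² − (n−1)·Σ_{α=0}^{n} 1/x_α² ≥ 0. -/

import Mathlib

/-- The `n × n` matrix `M(x₀,…,xₙ)` with `(i,j)` entry `(x₀+xᵢ)²` if `i = j` and
`x₀² + x₀xᵢ + x₀xⱼ − xᵢxⱼ` if `i ≠ j`, where rows/columns are indexed by `1,…,n`. -/
def morganMatrix (n : ℕ) (x : Fin (n + 1) → ℝ) : Matrix (Fin n) (Fin n) ℝ :=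
  Matrix.of fun i j =>
    if i = j then (x 0 + x i.succ) ^ 2
    else x 0 ^ 2 + x 0 * x i.succ + x 0 * x j.succ - x i.succ * x j.succ

open Matrix in
/-- The determinant of a matrix of the form `I + pqᵀ + rsᵀ`. -/
theorem Matrix.det_one_add_vecMulVec_add_vecMulVec {ι R : Type*} [Fintype ι] [DecidableEq ι]
    [CommRing R] (p q r s : ι → R) :
    (1 + (vecMulVec p q + vecMulVec r s)).det =
      (1 + q ⬝ᵥ p) * (1 + s ⬝ᵥ r) - (q ⬝ᵥ r) * (s ⬝ᵥ p) := by
  have h : vecMulVec p q + vecMulVec r s = (of ![p, r])ᵀ * of ![q, s] := by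
    ext i j
    simp [vecMulVec_apply, mul_apply, Fin.sum_univ_two]
  rw [h, det_one_add_mul_comm, det_fin_two]
  simp only [add_apply, mul_apply, transpose_apply, of_apply, dotProduct, one_fin_two]
  simp

open Matrix in
/-- `M(x₀,…,xₙ)` is a diagonal rescaling of a rank-two perturbation of the identity. -/
theorem morganMatrix_eq_diagonal_mul (n : ℕ) (x : Fin (n + 1) → ℝ) (hx : ∀ α, x α ≠ 0) :
    morganMatrix n x = diagonal (fun i => 2 * x i.succ) *
      (1 + (vecMulVec (fun i => x 0 / x i.succ) (fun j => x 0 / x j.succ) +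
        vecMulVec (fun i => -(1 - x 0 / x i.succ) / 2) (fun j => 1 - x 0 / x j.succ))) *
      diagonal (fun j => x j.succ) := by
  ext i j
  have hi := hx i.succ
  have hj := hx j.succ
  rw [mul_diagonal, diagonal_mul]
  by_cases hij : i = j
  · subst hij
    simp only [morganMatrix, of_apply, if_true, Matrix.add_apply, one_apply_eq, vecMulVec_apply]
    field_simp
    ring
  · simp only [morganMatrix, of_apply, if_neg hij, Matrix.add_apply, one_apply_ne hij, vecMulVec_apply]
    field_simp
    ring

open Matrix in
theorem det_morganMatrix (n : ℕ) (x : Fin (n + 1) → ℝ) (hx : ∀ α, x α ≠ 0) :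
    (morganMatrix n x).det =
      (∏ i : Fin n, 2 * x i.succ) * (∏ i : Fin n, x i.succ) * (x 0 ^ 2 / 2) *
        ((∑ α : Fin (n + 1), 1 / x α) ^ 2 -
          ((n : ℝ) - 1) * ∑ α : Fin (n + 1), 1 / (x α) ^ 2) := by
  have h0 := hx 0
  rw [morganMatrix_eq_diagonal_mul n x hx, det_mul, det_mul, det_diagonal, det_diagonal,
    det_one_add_vecMulVec_add_vecMulVec, Fin.sum_univ_succ, Fin.sum_univ_succ]
  set A := ∑ i : Fin n, 1 / x i.succ with hA
  set B := ∑ i : Fin n, 1 / x i.succ ^ 2 with hB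
  have hpp : (fun j : Fin n => x 0 / x j.succ) ⬝ᵥ (fun i => x 0 / x i.succ) = x 0 ^ 2 * B := by
    rw [dotProduct, hB, Finset.mul_sum]
    exact Finset.sum_congr rfl fun i _ => by ring
  have hpr : (fun j : Fin n => x 0 / x j.succ) ⬝ᵥ (fun i => -(1 - x 0 / x i.succ) / 2) =
      (x 0 ^ 2 * B - x 0 * A) / 2 := by
    rw [dotProduct, hA, hB, Finset.mul_sum, Finset.mul_sum, ← Finset.sum_sub_distrib,
      Finset.sum_div]
    exact Finset.sum_congr rfl fun i _ => by ring
  have hsp : (fun j : Fin n => 1 - x 0 / x j.succ) ⬝ᵥ (fun i => x 0 / x i.succ) =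
      x 0 * A - x 0 ^ 2 * B := by
    rw [dotProduct, hA, hB, Finset.mul_sum, Finset.mul_sum, ← Finset.sum_sub_distrib]
    exact Finset.sum_congr rfl fun i _ => by ring
  have hsr : (fun j : Fin n => 1 - x 0 / x j.succ) ⬝ᵥ (fun i => -(1 - x 0 / x i.succ) / 2) =
      -(n - 2 * (x 0 * A) + x 0 ^ 2 * B) / 2 := by
    have hn : (n : ℝ) = ∑ _i : Fin n, (1 : ℝ) := by simp
    rw [dotProduct, hA, hB, hn, Finset.mul_sum, Finset.mul_sum, Finset.mul_sum,
      ← Finset.sum_sub_distrib, ← Finset.sum_add_distrib, ← Finset.sum_neg_distrib,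
      Finset.sum_div]
    exact Finset.sum_congr rfl fun i _ => by ring
  rw [hpp, hpr, hsp, hsr]
  field_simp
  ring

/-- For positive `x₀,…,xₙ`, `det M(x₀,…,xₙ) ≥ 0` iff
`(Σ_α 1/x_α)² − (n−1)·Σ_α 1/x_α² ≥ 0`. -/
theorem det_morganMatrix_nonneg_iff (n : ℕ) (hn : 2 ≤ n) (x : Fin (n + 1) → ℝ)
    (hx : ∀ α, 0 < x α) :
    0 ≤ (morganMatrix n x).det ↔
      0 ≤ (∑ α : Fin (n + 1), 1 / x α) ^ 2 -
        ((n : ℝ) - 1) * ∑ α : Fin (n + 1), 1 / (x α) ^ 2 := by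
  rw [det_morganMatrix n x fun α => (hx α).ne']
  refine mul_nonneg_iff_of_pos_left (mul_pos (mul_pos ?_ ?_) ?_)
  · exact Finset.prod_pos fun i _ => mul_pos two_pos (hx _)
  · exact Finset.prod_pos fun i _ => hx _
  · exact half_pos (pow_pos (hx 0) 2)
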